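/- arXiv:1506.00095 — 3 statements merged into one kernel-verified Lean document; each statement's English description precedes it below -/
import Mathlib

section
/- Let S be a symmetric n×n real matrix and let X* be a point of the standard simplex Δ = {X ∈ ℝ^n : X ≥ 0, ∑ᵢ Xᵢ = 1}. Then X* is an evolutionarily stable strategy (ESS) of the doubly symmetric bimatrix game (S, S) if and only if X* is a strict local maximum over Δ of the quadratic form f(X) = (1/2) X·SX; that is, there exists a neighborhood O of X* in Δ such that (1/2) X*·SX* > (1/2) Y·SY for all Y ∈ O with Y ≠ X*. -/
open Matrix

/-- `Xs` is an evolutionarily stable strategy of the symmetric bimatrix game `(C, Cᵀ)`. -/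
def IsESS {n : ℕ} (C : Matrix (Fin n) (Fin n) ℝ) (Xs : Fin n → ℝ) : Prop :=
  ∃ O ∈ nhds Xs, ∀ X ∈ O, X ∈ stdSimplex ℝ (Fin n) → X ≠ Xs →
    Xs ⬝ᵥ C *ᵥ X > X ⬝ᵥ C *ᵥ X

/-- `Xs` is a strict local maximum of `f` over the standard simplex. -/
def IsStrictLocalMaxOnSimplex {n : ℕ} (f : (Fin n → ℝ) → ℝ) (Xs : Fin n → ℝ) : Prop :=
  ∃ O ∈ nhds Xs, ∀ Y ∈ O, Y ∈ stdSimplex ℝ (Fin n) → Y ≠ Xs → f Xs > f Y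

/-- For symmetric `S`, the difference of the quadratic form at `x` and at the reflection
`2 • y - x` of `x` through `y` is four times the payoff advantage of `x` over `y` against `y`. -/
lemma Matrix.IsSymm.dotProduct_mulVec_sub_reflection {ι : Type*} [Fintype ι]
    {S : Matrix ι ι ℝ} (hS : S.IsSymm) (x y : ι → ℝ) :
    x ⬝ᵥ S *ᵥ x - ((2 : ℝ) • y - x) ⬝ᵥ S *ᵥ ((2 : ℝ) • y - x) =
      4 * (x ⬝ᵥ S *ᵥ y - y ⬝ᵥ S *ᵥ y) := by
  have h : y ⬝ᵥ S *ᵥ x = x ⬝ᵥ S *ᵥ y := by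
    rw [dotProduct_mulVec, ← mulVec_transpose, hS.eq, dotProduct_comm]
  simp only [mulVec_sub, mulVec_smul, dotProduct_sub, sub_dotProduct, dotProduct_smul,
    smul_dotProduct, smul_eq_mul, h]
  ring

/-- Reflecting a point `x` of the simplex through a nearby point of the simplex stays in the
simplex. -/
lemma eventually_reflection_mem_stdSimplex {ι : Type*} [Fintype ι] {x : ι → ℝ}
    (hx : x ∈ stdSimplex ℝ ι) :
    ∀ᶠ y in nhds x, y ∈ stdSimplex ℝ ι → (2 : ℝ) • y - x ∈ stdSimplex ℝ ι := by
  have h : ∀ᶠ y in nhds x, ∀ i, 0 < x i → 0 < 2 * y i - x i := by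
    refine Filter.eventually_all.2 fun i => ?_
    by_cases hi : 0 < x i
    · have hc : ContinuousAt (fun y : ι → ℝ => 2 * y i - x i) x :=
        ((continuous_const.mul (continuous_apply i)).sub continuous_const).continuousAt
      filter_upwards [hc.eventually_const_lt (u := 0) (by linarith)] with y hy _ using hy
    · exact Filter.Eventually.of_forall fun y h => absurd h hi
  filter_upwards [h] with y hy hys
  refine ⟨fun i => ?_, ?_⟩
  · simp only [Pi.sub_apply, Pi.smul_apply, smul_eq_mul]
    rcases (hx.1 i).lt_or_eq with hi | hi
    · exact (hy i hi).le
    · have := hys.1 i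
      linarith
  · simp only [Pi.sub_apply, Pi.smul_apply, smul_eq_mul, Finset.sum_sub_distrib,
      ← Finset.mul_sum, hx.2, hys.2]
    norm_num

theorem ess_iff_strict_local_max_quadratic_form
    {n : ℕ} (S : Matrix (Fin n) (Fin n) ℝ) (hS : S.IsSymm) (Xs : Fin n → ℝ)
    (hXs : Xs ∈ stdSimplex ℝ (Fin n)) :
    IsESS S Xs ↔
      IsStrictLocalMaxOnSimplex (fun X => (1 / 2 : ℝ) * (X ⬝ᵥ S *ᵥ X)) Xs := by
  constructor
  · rintro ⟨O, hO, h⟩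
    have hc : ContinuousAt (fun Y : Fin n → ℝ => (1 / 2 : ℝ) • Xs + (1 / 2 : ℝ) • Y) Xs := by
      fun_prop
    have hfix : (1 / 2 : ℝ) • Xs + (1 / 2 : ℝ) • Xs = Xs := by module
    refine ⟨_, hc.preimage_mem_nhds (by rwa [hfix]), fun Y hY hYs hne => ?_⟩
    have hrefl : (2 : ℝ) • ((1 / 2 : ℝ) • Xs + (1 / 2 : ℝ) • Y) - Xs = Y := by module
    have hlt := h ((1 / 2 : ℝ) • Xs + (1 / 2 : ℝ) • Y) hY
      (convex_stdSimplex ℝ (Fin n) hXs hYs (by norm_num) (by norm_num) (by norm_num))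
      fun he => hne <| by
        rw [he] at hrefl
        rw [← hrefl]
        module
    have key := hS.dotProduct_mulVec_sub_reflection Xs ((1 / 2 : ℝ) • Xs + (1 / 2 : ℝ) • Y)
    rw [hrefl] at key
    dsimp only
    linarith
  · rintro ⟨O, hO, h⟩
    have hc : ContinuousAt (fun X : Fin n → ℝ => (2 : ℝ) • X - Xs) Xs := by fun_prop
    have hfix : (2 : ℝ) • Xs - Xs = Xs := by module
    refine ⟨_, Filter.inter_mem (hc.preimage_mem_nhds (by rwa [hfix]))
      (eventually_reflection_mem_stdSimplex hXs), fun X hX hXS hne => ?_⟩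
    have hlt := h ((2 : ℝ) • X - Xs) hX.1 (hX.2 hXS) fun he => hne <| by
      have hX2 : X = (1 / 2 : ℝ) • ((2 : ℝ) • X - Xs) + (1 / 2 : ℝ) • Xs := by module
      rw [hX2, he]
      module
    have key := hS.dotProduct_mulVec_sub_reflection Xs X
    dsimp only at hlt
    linarith
end

section
/- Let C be an n×n real matrix, let X* be a point of the standard simplex Δ = {X ∈ ℝ^n : X ≥ 0, ∑ᵢ Xᵢ = 1}, let c = CᵀX* ∈ ℝ^n, let 𝟙 ∈ ℝ^n be the all-ones vector, and define the symmetric matrix S = (C + Cᵀ) − 𝟙cᵀ − c𝟙ᵀ. Then X* is an evolutionarily stable strategy (ESS) of the symmetric bimatrix game (C, Cᵀ) if and only if X* is an evolutionarily stable strategy of the doubly symmetric bimatrix game (S, S). -/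
open Matrix

open Filter in
/-- Near a point `a` of the standard simplex, the reflection `2x - a` of `a` through a point `x` of
the simplex stays in the simplex. -/
theorem eventually_two_smul_sub_mem_stdSimplex {ι : Type*} [Fintype ι] {a : ι → ℝ}
    (ha : a ∈ stdSimplex ℝ ι) :
    ∀ᶠ x in nhds a, x ∈ stdSimplex ℝ ι → (2 : ℝ) • x - a ∈ stdSimplex ℝ ι := by
  have hpos : ∀ i, ∀ᶠ x in nhds a, 0 < a i → a i < 2 * x i := by
    intro i
    by_cases hi : 0 < a i
    · have hc : Continuous fun x : ι → ℝ => 2 * x i := by fun_prop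
      filter_upwards [hc.continuousAt.eventually (lt_mem_nhds (by linarith : a i < 2 * a i))]
        with x hx _ using hx
    · exact Eventually.of_forall fun x h => absurd h hi
  filter_upwards [eventually_all.2 hpos] with x hx hxs
  refine ⟨fun i => ?_, ?_⟩
  · rcases (ha.1 i).lt_or_eq with h | h
    · have := hx i h
      simp only [Pi.sub_apply, Pi.smul_apply, smul_eq_mul]
      linarith
    · have := hxs.1 i
      simp only [Pi.sub_apply, Pi.smul_apply, smul_eq_mul]
      linarith
  · simp only [Pi.sub_apply, Pi.smul_apply, smul_eq_mul, Finset.sum_sub_distrib, ← Finset.mul_sum,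
      hxs.2, ha.2]
    norm_num

/-- The payoff advantage of `a` against `x` in the rank-two update of `C + Cᵀ` is half its payoff
advantage in `C` against the reflection `2x - a`. -/
theorem two_mul_rank_two_update_advantage {ι : Type*} [Fintype ι] (C : Matrix ι ι ℝ)
    {a x : ι → ℝ} (ha : ∑ i, a i = 1) (hx : ∑ i, x i = 1) :
    let S : Matrix ι ι ℝ :=
      (C + Cᵀ) - vecMulVec (fun _ => 1) (Cᵀ *ᵥ a) - vecMulVec (Cᵀ *ᵥ a) (fun _ => 1)
    2 * (a ⬝ᵥ S *ᵥ x - x ⬝ᵥ S *ᵥ x) =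
      a ⬝ᵥ C *ᵥ ((2 : ℝ) • x - a) - ((2 : ℝ) • x - a) ⬝ᵥ C *ᵥ ((2 : ℝ) • x - a) := by
  intro S
  have htr : ∀ u v : ι → ℝ, u ⬝ᵥ Cᵀ *ᵥ v = v ⬝ᵥ C *ᵥ u := fun u v => by
    rw [mulVec_transpose, dotProduct_comm, dotProduct_mulVec]
  have hone : ∀ u : ι → ℝ, u ⬝ᵥ (fun _ => (1 : ℝ)) = ∑ i, u i := fun u => by
    simp [dotProduct]
  have hS : ∀ u v : ι → ℝ, u ⬝ᵥ S *ᵥ v =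
      u ⬝ᵥ C *ᵥ v + v ⬝ᵥ C *ᵥ u - (∑ i, u i) * (a ⬝ᵥ C *ᵥ v) - (a ⬝ᵥ C *ᵥ u) * ∑ i, v i := by
    intro u v
    simp only [S, sub_mulVec, add_mulVec, dotProduct_sub, dotProduct_add, vecMulVec_mulVec, htr,
      op_smul_eq_smul, dotProduct_smul, smul_eq_mul, hone]
    rw [dotProduct_comm (Cᵀ *ᵥ a) v, dotProduct_comm (fun _ => (1 : ℝ)) v, htr, hone]
    ring
  rw [hS, hS, ha, hx]
  simp only [mulVec_sub, mulVec_smul, dotProduct_sub, sub_dotProduct, smul_dotProduct,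
    dotProduct_smul, smul_eq_mul]
  ring

theorem ess_iff_ess_of_rank_two_update
    {n : ℕ} (C : Matrix (Fin n) (Fin n) ℝ) (Xs : Fin n → ℝ)
    (hXs : Xs ∈ stdSimplex ℝ (Fin n)) :
    let c : Fin n → ℝ := Cᵀ *ᵥ Xs
    let one : Fin n → ℝ := fun _ => 1
    let S : Matrix (Fin n) (Fin n) ℝ := (C + Cᵀ) - vecMulVec one c - vecMulVec c one
    IsESS C Xs ↔ IsESS S Xs := by
  intro c one S
  have key : ∀ x ∈ stdSimplex ℝ (Fin n), 2 * (Xs ⬝ᵥ S *ᵥ x - x ⬝ᵥ S *ᵥ x) = _ := fun x hx =>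
    two_mul_rank_two_update_advantage C hXs.2 hx.2
  constructor
  · rintro ⟨O, hO, h⟩
    have hc : Continuous fun x : Fin n → ℝ => (2 : ℝ) • x - Xs := by fun_prop
    have hO' : ∀ᶠ x in nhds Xs, (2 : ℝ) • x - Xs ∈ O :=
      hc.continuousAt.eventually_mem (by simpa [two_smul] using hO)
    refine ⟨_, hO'.and (eventually_two_smul_sub_mem_stdSimplex hXs), ?_⟩
    rintro x ⟨hxO, hxs⟩ hx hne
    have hne' : (2 : ℝ) • x - Xs ≠ Xs := by
      intro he
      apply hne
      rw [sub_eq_iff_eq_add, ← two_smul ℝ Xs] at he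
      exact smul_right_injective _ two_ne_zero he
    have := h _ hxO (hxs hx) hne'
    have := key x hx
    linarith
  · rintro ⟨O, hO, h⟩
    have hc : Continuous fun y : Fin n → ℝ => midpoint ℝ Xs y := by
      simp only [midpoint_eq_smul_add]
      fun_prop
    refine ⟨_, hc.continuousAt.preimage_mem_nhds (by simpa using hO), ?_⟩
    intro y hyO hy hne
    have hm : midpoint ℝ Xs y ∈ stdSimplex ℝ (Fin n) :=
      (convex_stdSimplex ℝ (Fin n)).midpoint_mem hXs hy
    have h1 := h _ hyO hm (by simpa [midpoint_eq_left_iff, eq_comm] using hne)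
    have h2 := key _ hm
    have h3 : (2 : ℝ) • midpoint ℝ Xs y - Xs = y := by
      rw [two_smul, midpoint_add_self, add_sub_cancel_left]
    rw [h3] at h2
    linarith
end

section
/- Let C be an n×n real matrix and let X* be an evolutionarily stable strategy (ESS) of the symmetric bimatrix game (C, Cᵀ). Then X* is an isolated symmetric Nash equilibrium strategy: X* is a symmetric Nash equilibrium strategy of (C, Cᵀ), and there exists a neighborhood O of X* in the standard simplex Δ such that no point of O other than X* is a symmetric Nash equilibrium strategy of (C, Cᵀ). -/
open Matrix

/-- `P` is a symmetric Nash equilibrium strategy of `(C, Cᵀ)`. -/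
def IsSymNash {n : ℕ} (C : Matrix (Fin n) (Fin n) ℝ) (P : Fin n → ℝ) : Prop :=
  P ∈ stdSimplex ℝ (Fin n) ∧
    ∀ Q ∈ stdSimplex ℝ (Fin n), P ⬝ᵥ C *ᵥ P ≥ Q ⬝ᵥ C *ᵥ P

/-- An evolutionarily stable strategy is a best reply to itself. -/
theorem IsESS.isSymNash {n : ℕ} {C : Matrix (Fin n) (Fin n) ℝ} {Xs : Fin n → ℝ}
    (hXs : Xs ∈ stdSimplex ℝ (Fin n)) (hESS : IsESS C Xs) : IsSymNash C Xs := by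
  obtain ⟨O, hO, h⟩ := hESS
  refine ⟨hXs, fun Q hQ => ?_⟩
  rcases eq_or_ne Q Xs with rfl | hne
  · exact le_rfl
  have hline : Continuous fun t : ℝ => Xs + t • (Q - Xs) := by fun_prop
  have hpay : Continuous fun t : ℝ => (Q - Xs) ⬝ᵥ C *ᵥ (Xs + t • (Q - Xs)) := by
    simp only [mulVec_add, mulVec_smul, dotProduct_add, dotProduct_smul]
    fun_prop
  have hO' : ∀ᶠ t in nhdsWithin (0 : ℝ) (Set.Ioi 0), Xs + t • (Q - Xs) ∈ O :=
    (hline.tendsto' 0 Xs (by simp)).mono_left nhdsWithin_le_nhds hO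
  have hlim := (hpay.tendsto' 0 ((Q - Xs) ⬝ᵥ C *ᵥ Xs) (by simp)).mono_left
    (nhdsWithin_le_nhds (s := Set.Ioi (0 : ℝ)))
  have hle : (Q - Xs) ⬝ᵥ C *ᵥ Xs ≤ 0 := by
    refine le_of_tendsto hlim ?_
    filter_upwards [hO', Ioo_mem_nhdsGT (zero_lt_one' ℝ)] with t htO ht
    have hmem : Xs + t • (Q - Xs) ∈ stdSimplex ℝ (Fin n) :=
      (convex_stdSimplex ℝ (Fin n)).add_smul_sub_mem hXs hQ ⟨ht.1.le, ht.2.le⟩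
    have hX : Xs + t • (Q - Xs) ≠ Xs := by
      simpa [sub_eq_zero, ht.1.ne'] using hne
    have hlt := h _ htO hmem hX
    rw [gt_iff_lt, add_dotProduct, smul_dotProduct, smul_eq_mul, add_lt_iff_neg_left] at hlt
    exact (neg_of_mul_neg_right hlt ht.1.le).le
  simpa [sub_dotProduct] using hle

theorem ess_isolated_symmetric_nash
    {n : ℕ} (C : Matrix (Fin n) (Fin n) ℝ) (Xs : Fin n → ℝ)
    (hXs : Xs ∈ stdSimplex ℝ (Fin n)) (hESS : IsESS C Xs) :
    IsSymNash C Xs ∧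
      ∃ O ∈ nhds Xs, ∀ P ∈ O, P ∈ stdSimplex ℝ (Fin n) → P ≠ Xs → ¬ IsSymNash C P := by
  refine ⟨hESS.isSymNash hXs, ?_⟩
  obtain ⟨O, hO, h⟩ := hESS
  exact ⟨O, hO, fun P hPO hP hne hNash => (h P hPO hP hne).not_ge (hNash.2 Xs hXs)⟩
end
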